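/- arXiv:2407.02689 — 4 statements merged into one kernel-verified Lean document; each statement's English description precedes it below -/
import Mathlib

section
/- Let F: ℝⁿ → ℝ be μ-strongly convex and L-smooth (0 < μ ≤ L), with minimizer value F* = min F, and let Δ = F(x⁰) − F* for a given x⁰. Set q = μ/(μ + 2L), α₀ = √q, y¹ = x⁰ and also write x⁰ for the iterate at step 0. For s = 1, 2, …, S, let x^s satisfy F(x^s) + L‖x^s − y^s‖² ≤ min_x [ F(x) + L‖x − y^s‖² ] + ε^s with ε^s = (2/9)(1 − 0.9√q)^s Δ, let α_s ∈ (0,1) solve α_s² = (1 − α_s)α_{s−1}² + q α_s, let β_s = α_{s−1}(1 − α_{s−1})/(α_{s−1}² + α_s), and set y^{s+1} = x^s + β_s (x^s − x^{s−1}). Then F(x^S) − F* ≤ 800 (1 − 0.9√q)^{S+1} Δ / q. -/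
/-
STATEMENT 10: Catalyst guarantee for μ-strongly convex, L-smooth F (0 < μ ≤ L):
with q = μ/(μ+2L), α₀ = √q, y¹ = x⁰, inexact proximal steps
F(x^s) + L‖x^s − y^s‖² ≤ min_x [F(x) + L‖x − y^s‖²] + ε^s, ε^s = (2/9)(1−0.9√q)^s Δ,
momentum coefficients α_s ∈ (0,1) with α_s² = (1−α_s)α_{s−1}² + qα_s,
β_s = α_{s−1}(1−α_{s−1})/(α_{s−1}²+α_s), and y^{s+1} = x^s + β_s(x^s − x^{s−1}),
one has F(x^S) − F* ≤ 800(1−0.9√q)^{S+1}Δ/q, where Δ = F(x⁰) − F*.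
-/

noncomputable section

open scoped RealInnerProductSpace

section InexactProximalPoint

variable {E : Type*} [NormedAddCommGroup E] [InnerProductSpace ℝ E]

/-- The squared norm along a segment. -/
theorem norm_sq_convex_combination (p r : E) (t : ℝ) :
    ‖p + t • (r - p)‖ ^ 2 = (1 - t) * ‖p‖ ^ 2 + t * ‖r‖ ^ 2 - t * (1 - t) * ‖r - p‖ ^ 2 := by
  rw [norm_add_sq_real, norm_smul, mul_pow, inner_smul_right, inner_sub_right,
    norm_sub_sq_real, real_inner_self_eq_norm_sq, Real.norm_eq_abs, sq_abs,
    real_inner_comm p r]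
  ring

/-- The first-order form of strong convexity implies the segment form. -/
theorem strong_convexity_segment {F : E → ℝ} {g : E → E} {μ : ℝ}
    (hsc : ∀ x y, F x + ⟪g x, y - x⟫ + μ / 2 * ‖y - x‖ ^ 2 ≤ F y)
    {t : ℝ} (ht0 : 0 ≤ t) (ht1 : t ≤ 1) (x z : E) :
    F (x + t • (z - x)) ≤ (1 - t) * F x + t * F z - μ / 2 * (t * (1 - t)) * ‖z - x‖ ^ 2 := by
  have hx := hsc (x + t • (z - x)) x
  have hz := hsc (x + t • (z - x)) z
  have ex : x - (x + t • (z - x)) = (-t) • (z - x) := by module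
  have ez : z - (x + t • (z - x)) = (1 - t) • (z - x) := by module
  rw [ex, inner_smul_right, norm_smul, mul_pow, Real.norm_eq_abs, sq_abs] at hx
  rw [ez, inner_smul_right, norm_smul, mul_pow, Real.norm_eq_abs, sq_abs] at hz
  linear_combination (1 - t) * hx + t * hz

/-- Quadratic growth of the proximal objective around an `ε`-approximate minimizer. -/
theorem approx_prox_growth {F : E → ℝ} {g : E → E} {μ L ε c : ℝ}
    (hsc : ∀ x y, F x + ⟪g x, y - x⟫ + μ / 2 * ‖y - x‖ ^ 2 ≤ F y)
    (hc0 : 0 < c) (hc1 : c ≤ 1) {x y : E}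
    (hx : ∀ z, F x + L * ‖x - y‖ ^ 2 ≤ F z + L * ‖z - y‖ ^ 2 + ε) (z : E) :
    F x + L * ‖x - y‖ ^ 2 + (1 - c) * ((μ + 2 * L) / 2) * ‖z - x‖ ^ 2 ≤
      F z + L * ‖z - y‖ ^ 2 + ε / c := by
  have h := hx (x + c • (z - x))
  have hF := strong_convexity_segment hsc hc0.le hc1 x z
  have hn := norm_sq_convex_combination (x - y) (z - y) c
  rw [sub_sub_sub_cancel_right, show x - y + c • (z - x) = x + c • (z - x) - y by abel] at hn
  rw [hn] at h
  refine le_of_mul_le_mul_left ?_ hc0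
  rw [mul_add c _ (ε / c), mul_div_cancel₀ _ hc0.ne']
  linear_combination h + hF

/-- One step of the inexact accelerated proximal point method contracts the Lyapunov function
`F x - F xs + μ / 2 * ‖xs - v‖ ^ 2`, up to the accuracy of the subproblem. -/
theorem inexact_prox_step {F : E → ℝ} {g : E → E} {μ L ε a c : ℝ}
    (hsc : ∀ x y, F x + ⟪g x, y - x⟫ + μ / 2 * ‖y - x‖ ^ 2 ≤ F y)
    (hL : 0 ≤ L) (ha0 : 0 < a) (ha1 : a ≤ 1) (haL : a ^ 2 * (μ + 2 * L) = μ)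
    (hc0 : 0 < c) (hc1 : c ≤ 1) {x v x' y xs : E} (hxs : ∀ z, F xs ≤ F z)
    (hy : y = x + (a / (1 + a)) • (v - x))
    (hx' : ∀ z, F x' + L * ‖x' - y‖ ^ 2 ≤ F z + L * ‖z - y‖ ^ 2 + ε) :
    (1 - c) * (F x' - F xs + μ / 2 * ‖xs - (x + a⁻¹ • (x' - x))‖ ^ 2) ≤
      (1 - a) * (F x - F xs + μ / 2 * ‖xs - v‖ ^ 2) + ε / c := by
  have hgrow := approx_prox_growth hsc hc0 hc1 hx' (x + a • (xs - x))
  have hF := strong_convexity_segment hsc ha0.le ha1 x xs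
  have hv : x + a • (xs - x) - x' = a • (xs - (x + a⁻¹ • (x' - x))) := by
    match_scalars <;> field_simp <;> ring
  rw [hv, norm_smul, mul_pow, Real.norm_eq_abs, sq_abs] at hgrow
  have hzy : x + a • (xs - x) - y = a • ((xs - v) + (a / (1 + a)) • ((xs - x) - (xs - v))) := by
    rw [hy]
    match_scalars <;> field_simp <;> ring
  have hnorm := norm_sq_convex_combination (xs - v) (xs - x) (a / (1 + a))
  have hprox : L * ‖x + a • (xs - x) - y‖ ^ 2 ≤
      μ / 2 * (1 - a) * (a * ‖xs - x‖ ^ 2 + ‖xs - v‖ ^ 2) := by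
    have hle : ‖xs - v + (a / (1 + a)) • (xs - x - (xs - v))‖ ^ 2 ≤
        (a * ‖xs - x‖ ^ 2 + ‖xs - v‖ ^ 2) / (1 + a) := by
      rw [hnorm, show 1 - a / (1 + a) = 1 / (1 + a) by field_simp; ring]
      have : 0 ≤ a / (1 + a) * (1 / (1 + a)) * ‖xs - x - (xs - v)‖ ^ 2 := by positivity
      have e : (a * ‖xs - x‖ ^ 2 + ‖xs - v‖ ^ 2) / (1 + a) =
        1 / (1 + a) * ‖xs - v‖ ^ 2 + a / (1 + a) * ‖xs - x‖ ^ 2 := by ring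
      linarith
    have hκ : L * a ^ 2 = μ / 2 * (1 - a) * (1 + a) := by linear_combination haL / 2
    rw [hzy, norm_smul, mul_pow, Real.norm_eq_abs, sq_abs, ← mul_assoc]
    refine (mul_le_mul_of_nonneg_left hle (by positivity)).trans_eq ?_
    rw [hκ]
    field_simp
  have hsq : 0 ≤ L * ‖x' - y‖ ^ 2 := by positivity
  have hgap : 0 ≤ c * (F x' - F xs) := mul_nonneg hc0.le (sub_nonneg.2 (hxs x'))
  linear_combination hgrow + hF + hprox + hsq + hgap -
    (1 - c) / 2 * ‖xs - (x + a⁻¹ • (x' - x))‖ ^ 2 * haL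

end InexactProximalPoint

theorem statement10 {N : ℕ} (μ L : ℝ) (hμ : 0 < μ) (hμL : μ ≤ L)
    (F : EuclideanSpace ℝ (Fin N) → ℝ) (hdiff : Differentiable ℝ F)
    (hsc : ∀ x y, F x + ⟪gradient F x, y - x⟫ + μ / 2 * ‖y - x‖ ^ 2 ≤ F y)
    (hsm : ∀ x y, ‖gradient F x - gradient F y‖ ≤ L * ‖x - y‖)
    (Fstar : ℝ) (hFstar : ∀ x, Fstar ≤ F x) (hattain : ∃ x, F x = Fstar)
    (q Δ : ℝ) (hq : q = μ / (μ + 2 * L))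
    (S : ℕ)
    (x y : ℕ → EuclideanSpace ℝ (Fin N)) (α : ℕ → ℝ)
    (hΔ : Δ = F (x 0) - Fstar)
    (hα0 : α 0 = Real.sqrt q)
    (hy1 : y 1 = x 0)
    (hα : ∀ s, 1 ≤ s → s ≤ S →
      α s ∈ Set.Ioo (0 : ℝ) 1 ∧ (α s) ^ 2 = (1 - α s) * (α (s - 1)) ^ 2 + q * α s)
    (hx : ∀ s, 1 ≤ s → s ≤ S → ∀ z,
      F (x s) + L * ‖x s - y s‖ ^ 2 ≤
        F z + L * ‖z - y s‖ ^ 2 + 2 / 9 * (1 - 0.9 * Real.sqrt q) ^ s * Δ)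
    (hy : ∀ s, 1 ≤ s → s ≤ S →
      y (s + 1) = x s +
        (α (s - 1) * (1 - α (s - 1)) / ((α (s - 1)) ^ 2 + α s)) • (x s - x (s - 1))) :
    F (x S) - Fstar ≤ 800 * (1 - 0.9 * Real.sqrt q) ^ (S + 1) * Δ / q := by
  obtain ⟨xs, rfl⟩ := hattain
  have hL : 0 < L := hμ.trans_le hμL
  have hq0 : 0 < q := hq ▸ by positivity
  have hq1 : q ≤ 1 / 3 := by
    rw [hq, div_le_div_iff₀ (by positivity) (by norm_num)]
    linarith
  obtain ⟨a, ha⟩ : ∃ a, a = Real.sqrt q := ⟨_, rfl⟩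
  rw [← ha] at hα0 hx ⊢
  have ha0 : 0 < a := ha ▸ Real.sqrt_pos.2 hq0
  have haq : a ^ 2 = q := ha ▸ Real.sq_sqrt hq0.le
  have ha1 : a ≤ 3 / 5 := by nlinarith
  have haL : a ^ 2 * (μ + 2 * L) = μ := by
    rw [haq, hq]
    field_simp
  have hΔ0 : 0 ≤ Δ := hΔ ▸ sub_nonneg.2 (hFstar _)
  have hαa : ∀ s, s ≤ S → α s = a := by
    intro s
    induction s with
    | zero => exact fun _ => hα0
    | succ s ih =>
      intro hs
      obtain ⟨⟨hpos, -⟩, heq⟩ := hα (s + 1) s.succ_pos hs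
      rw [Nat.add_sub_cancel, ih (by omega)] at heq
      have hsq : α (s + 1) ^ 2 = a ^ 2 := by linear_combination heq - α (s + 1) * haq
      exact (pow_left_inj₀ hpos.le ha0.le two_ne_zero).1 hsq
  have hyv : ∀ s, s ≤ S → y (s + 1) =
      x s + (a / (1 + a)) • (x (s - 1) + a⁻¹ • (x s - x (s - 1)) - x s) := by
    intro s hs
    rcases Nat.eq_zero_or_pos s with rfl | hpos
    · simp [hy1]
    · rw [hy s hpos hs, hαa s hs, hαa (s - 1) (by omega)]
      match_scalars <;> field_simp <;> ring
  have hR : 0 < 1 - 0.9 * a := by norm_num; linarith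
  have key : ∀ s, s ≤ S →
      F (x s) - F xs + μ / 2 * ‖xs - (x (s - 1) + a⁻¹ • (x s - x (s - 1)))‖ ^ 2 ≤
        800 * (1 - 0.9 * a) ^ (s + 1) * Δ / q := by
    intro s
    induction s with
    | zero =>
      intro _
      have h := strong_convexity_segment hsc (t := 1 / 2) (by norm_num) (by norm_num) (x 0) xs
      have hmin := hFstar (x 0 + (1 / 2 : ℝ) • (xs - x 0))
      have h3 : 3 * Δ ≤ 800 * (1 - 0.9 * a) ^ (0 + 1) * Δ / q := by
        rw [le_div_iff₀ hq0]
        nlinarith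
      simp only [Nat.zero_sub, sub_self, smul_zero, add_zero]
      linarith
    | succ s ih =>
      intro hs
      have hstep := inexact_prox_step (c := a / 20) hsc hL.le ha0 (by linarith) haL
        (by positivity) (by linarith) hFstar (hyv s (by omega)) (hx (s + 1) s.succ_pos hs)
      have hih := mul_le_mul_of_nonneg_left (ih (by omega)) (show 0 ≤ 1 - a by linarith)
      have hc : 0 < 1 - a / 20 := by linarith
      refine le_of_mul_le_mul_left ((hstep.trans (add_le_add_left hih _)).trans ?_) hc
      have hP : 0 ≤ (1 - 0.9 * a) ^ (s + 1) * Δ := by positivity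
      have hnum : (1 - a) * 800 / a ^ 2 + 2 / 9 / (a / 20) ≤
          (1 - a / 20) * (800 * (1 - 0.9 * a)) / a ^ 2 := by
        rw [← sub_nonneg]
        have e : (1 - a / 20) * (800 * (1 - 0.9 * a)) / a ^ 2 -
            ((1 - a) * 800 / a ^ 2 + 2 / 9 / (a / 20)) = (320 / 9 + 36 * a) / a := by
          field_simp
          ring
        rw [e]
        positivity
      rw [← haq]
      calc _ = ((1 - a) * 800 / a ^ 2 + 2 / 9 / (a / 20)) * ((1 - 0.9 * a) ^ (s + 1) * Δ) := by
            ring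
        _ ≤ _ := mul_le_mul_of_nonneg_right hnum hP
        _ = _ := by ring
  have hS := key S le_rfl
  have : 0 ≤ μ / 2 * ‖xs - (x (S - 1) + a⁻¹ • (x S - x (S - 1)))‖ ^ 2 := by positivity
  linarith
end
end

section
/- Let F: ℝⁿ → ℝ be convex and L-smooth, attaining its minimum F* at a point x*, and let Δ = F(x⁰) − F* for a given x⁰. Set q = 0, α₀ = 1, y¹ = x⁰, and fix γ > 0. For s = 1, 2, …, S, let x^s satisfy F(x^s) + L‖x^s − y^s‖² ≤ min_x [ F(x) + L‖x − y^s‖² ] + ε^s with ε^s = 2Δ/(9(s+1)^{4+γ}), let α_s ∈ (0,1) solve α_s² = (1 − α_s)α_{s−1}², let β_s = α_{s−1}(1 − α_{s−1})/(α_{s−1}² + α_s), and set y^{s+1} = x^s + β_s (x^s − x^{s−1}) (with x⁰ as the iterate at step 0). Then F(x^S) − F* ≤ (8/(S+1)²) ( L‖x⁰ − x*‖² + 4Δ/γ² ). -/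
/-
STATEMENT 11: Catalyst guarantee for convex L-smooth F attaining its minimum at x*:
with q = 0, α₀ = 1, y¹ = x⁰, γ > 0, inexact proximal steps
F(x^s) + L‖x^s − y^s‖² ≤ min_x [F(x) + L‖x − y^s‖²] + ε^s, ε^s = 2Δ/(9(s+1)^{4+γ}),
α_s ∈ (0,1) with α_s² = (1−α_s)α_{s−1}², β_s = α_{s−1}(1−α_{s−1})/(α_{s−1}²+α_s),
y^{s+1} = x^s + β_s(x^s − x^{s−1}), it holds that
F(x^S) − F* ≤ (8/(S+1)²)(L‖x⁰ − x*‖² + 4Δ/γ²), where Δ = F(x⁰) − F*.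
-/

noncomputable section

open scoped RealInnerProductSpace

section InexactProximal

variable {E : Type*} [NormedAddCommGroup E] [InnerProductSpace ℝ E]

lemma norm_sq_convex_comb (a b : E) (θ : ℝ) :
    ‖(1 - θ) • a + θ • b‖ ^ 2 =
      (1 - θ) * ‖a‖ ^ 2 + θ * ‖b‖ ^ 2 - θ * (1 - θ) * ‖a - b‖ ^ 2 := by
  rw [norm_add_sq_real, norm_sub_sq_real, norm_smul, norm_smul, real_inner_smul_left,
    real_inner_smul_right, mul_pow, mul_pow, Real.norm_eq_abs, Real.norm_eq_abs, sq_abs, sq_abs]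
  ring

/-- An approximate proximal point satisfies a relaxed three-point inequality. -/
lemma inexact_prox_three_point {F : E → ℝ} (hF : ConvexOn ℝ Set.univ F) {l e : ℝ} (hl : 0 ≤ l)
    (he : 0 ≤ e) {x y : E}
    (hx : ∀ z, F x + l ^ 2 * ‖x - y‖ ^ 2 ≤ F z + l ^ 2 * ‖z - y‖ ^ 2 + e ^ 2) (z : E) :
    F x + l ^ 2 * ‖x - y‖ ^ 2 + l ^ 2 * ‖x - z‖ ^ 2 ≤
      F z + l ^ 2 * ‖z - y‖ ^ 2 + e ^ 2 + 2 * e * (l * ‖x - z‖) := by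
  have key : ∀ θ : ℝ, 0 < θ → θ ≤ 1 →
      θ * (F x + l ^ 2 * ‖x - y‖ ^ 2 + (1 - θ) * (l * ‖x - z‖) ^ 2) ≤
        θ * (F z + l ^ 2 * ‖z - y‖ ^ 2) + e ^ 2 := by
    intro θ h0 h1
    have h := hx ((1 - θ) • x + θ • z)
    have hc := hF.2 (Set.mem_univ x) (Set.mem_univ z) (sub_nonneg.2 h1) h0.le (by ring)
    have hn : (1 - θ) • x + θ • z - y = (1 - θ) • (x - y) + θ • (z - y) := by module
    rw [hn, norm_sq_convex_comb, sub_sub_sub_cancel_right] at h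
    simp only [smul_eq_mul] at hc
    nlinarith
  set r := l * ‖x - z‖ with hr
  have hr0 : 0 ≤ r := by positivity
  have hrr : l ^ 2 * ‖x - z‖ ^ 2 = r ^ 2 := by rw [hr]; ring
  rw [hrr]
  rcases le_or_gt r e with hre | hre
  · have := hx z
    nlinarith
  · have hrpos : 0 < r := he.trans_lt hre
    rcases he.eq_or_lt with h0 | hpos
    · subst h0
      refine le_of_forall_pos_le_add fun δ hδ => ?_
      have hd : 0 < r ^ 2 + δ := by positivity
      have hθ0 : 0 < δ / (r ^ 2 + δ) := by positivity
      have h := key (δ / (r ^ 2 + δ)) hθ0 ((div_le_one hd).2 (by nlinarith))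
      rw [zero_pow two_ne_zero, add_zero] at h
      have h' := le_of_mul_le_mul_left h hθ0
      have hδr : δ / (r ^ 2 + δ) * r ^ 2 ≤ δ := by
        rw [div_mul_eq_mul_div, div_le_iff₀ hd]
        nlinarith
      linarith
    · have hθ0 : 0 < e / r := by positivity
      have h := key (e / r) hθ0 ((div_le_one hrpos).2 hre.le)
      have h' : F x + l ^ 2 * ‖x - y‖ ^ 2 + (1 - e / r) * r ^ 2 ≤
          F z + l ^ 2 * ‖z - y‖ ^ 2 + e * r := by
        refine le_of_mul_le_mul_left (h.trans_eq ?_) hθ0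
        field_simp
      have h'' : (1 - e / r) * r ^ 2 = r ^ 2 - e * r := by field_simp
      nlinarith

/-- One step of the inexact accelerated proximal point method. -/
lemma inexact_accelerated_prox_step {F : E → ℝ} (hF : ConvexOn ℝ Set.univ F) {l e a : ℝ}
    (hl : 0 ≤ l) (he : 0 ≤ e) (ha0 : 0 < a) (ha1 : a ≤ 1) {x y p u w : E}
    (hx : ∀ z, F x + l ^ 2 * ‖x - y‖ ^ 2 ≤ F z + l ^ 2 * ‖z - y‖ ^ 2 + e ^ 2)
    (hy : y = p + a • (u - p)) :
    (1 / a) ^ 2 * (F x - F w) + (l * ‖p + (1 / a) • (x - p) - w‖) ^ 2 ≤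
      (1 - a) * (1 / a) ^ 2 * (F p - F w) + (l * ‖u - w‖) ^ 2 + (1 / a * e) ^ 2 +
        2 * (1 / a * e) * (l * ‖p + (1 / a) • (x - p) - w‖) := by
  set v := p + (1 / a) • (x - p) with hv
  have h := inexact_prox_three_point hF hl he hx ((1 - a) • p + a • w)
  have hc := hF.2 (Set.mem_univ p) (Set.mem_univ w) (sub_nonneg.2 ha1) ha0.le (by ring)
  have hzy : (1 - a) • p + a • w - y = (-a) • (u - w) := by rw [hy]; module
  have hxv : x = p + a • (v - p) := by
    rw [hv, add_sub_cancel_left, smul_smul, mul_one_div_cancel ha0.ne', one_smul]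
    abel
  have hxz : x - ((1 - a) • p + a • w) = a • (v - w) := by
    rw [hxv]; module
  rw [hzy, hxz, norm_smul, norm_smul, norm_neg, Real.norm_of_nonneg ha0.le] at h
  simp only [smul_eq_mul] at hc
  have hnn : 0 ≤ l ^ 2 * ‖x - y‖ ^ 2 := by positivity
  have h2 : (F x - F w) + (a * (l * ‖v - w‖)) ^ 2 ≤ (1 - a) * (F p - F w) +
      (a * (l * ‖u - w‖)) ^ 2 + e ^ 2 + 2 * e * (a * (l * ‖v - w‖)) := by
    nlinarith
  have h3 := mul_le_mul_of_nonneg_left h2 (sq_nonneg (1 / a))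
  have e1 : (1 / a) ^ 2 * ((F x - F w) + (a * (l * ‖v - w‖)) ^ 2) =
      (1 / a) ^ 2 * (F x - F w) + (l * ‖v - w‖) ^ 2 := by
    field_simp
  have e2 : (1 / a) ^ 2 * ((1 - a) * (F p - F w) +
      (a * (l * ‖u - w‖)) ^ 2 + e ^ 2 + 2 * e * (a * (l * ‖v - w‖))) =
      (1 - a) * (1 / a) ^ 2 * (F p - F w) + (l * ‖u - w‖) ^ 2 + (1 / a * e) ^ 2 +
        2 * (1 / a * e) * (l * ‖v - w‖) := by
    field_simp
  linarith

end InexactProximal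

lemma rpow_neg_one_sub_le_telescope {m p : ℝ} (hm : 0 < m) (hp : 0 < p) :
    (m + 1) ^ (-1 - p) ≤ 1 / p * (m ^ (-p) - (m + 1) ^ (-p)) := by
  have hm1 : 0 < m + 1 := by linarith
  have hlog := Real.one_sub_inv_le_log_of_pos (div_pos hm1 hm)
  rw [inv_div, one_sub_div hm1.ne', add_sub_cancel_left] at hlog
  have hexp := Real.add_one_le_exp (p * Real.log ((m + 1) / m))
  have hratio : Real.exp (p * Real.log ((m + 1) / m)) = (m + 1) ^ p / m ^ p := by
    rw [← Real.div_rpow hm1.le hm.le, Real.rpow_def_of_pos (div_pos hm1 hm), mul_comm]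
  have hq : 0 < (m + 1) ^ (-p) := Real.rpow_pos_of_pos hm1 _
  have hmul : (m + 1) ^ (-p) * ((m + 1) ^ p / m ^ p) = m ^ (-p) := by
    rw [Real.rpow_neg hm1.le, Real.rpow_neg hm.le]
    have := Real.rpow_pos_of_pos hm1 p
    field_simp
  have hsplit : (m + 1) ^ (-1 - p) = (m + 1) ^ (-p) * (1 / (m + 1)) := by
    rw [show -1 - p = -p + -1 by ring, Real.rpow_add hm1, Real.rpow_neg_one, one_div]
  rw [hratio] at hexp
  have h1 : 1 + p * (1 / (m + 1)) ≤ (m + 1) ^ p / m ^ p := by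
    nlinarith
  have h2 := mul_le_mul_of_nonneg_left h1 hq.le
  rw [hmul] at h2
  rw [hsplit, one_div_mul_eq_div, le_div_iff₀ hp]
  linarith

lemma le_add_of_sq_le_recursion {u v a : ℝ} (hu : 0 ≤ u) (ha : 0 ≤ a)
    (h : v ^ 2 ≤ u ^ 2 + a ^ 2 + 2 * a * v) : v ≤ u + 5 / 2 * a := by
  by_contra! hlt
  nlinarith [mul_nonneg hu ha, mul_self_nonneg a]

/-- Linear growth of the reciprocals of the accelerated step parameters. -/
lemma accelerated_inv_bounds {α : ℕ → ℝ} {n : ℕ} (h0 : α 0 = 1)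
    (h : ∀ k < n, 0 < α (k + 1) ∧ α (k + 1) ^ 2 = (1 - α (k + 1)) * α k ^ 2) :
    ∀ k ≤ n, 0 < α k ∧ α k ≤ 1 ∧ ((k : ℝ) + 2) / 2 ≤ 1 / α k ∧
      1 / α k ≤ 3 / 4 * ((k : ℝ) + 2) := by
  intro k
  induction k with
  | zero => intro _; norm_num [h0]
  | succ k ih =>
    intro hk
    obtain ⟨hp, -, hlo, hhi⟩ := ih (by omega)
    obtain ⟨hq, heq⟩ := h k (by omega)
    have hrec : (1 / α (k + 1)) ^ 2 - 1 / α (k + 1) = (1 / α k) ^ 2 := by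
      field_simp
      linarith
    have ht : 1 ≤ 1 / α k := by
      have : (0 : ℝ) ≤ k := k.cast_nonneg
      linarith
    have hs : 0 < 1 / α (k + 1) := by positivity
    have hlow : 1 / α k + 1 / 2 ≤ 1 / α (k + 1) := by
      by_contra! hlt
      nlinarith
    have hupp : 1 / α (k + 1) ≤ 1 / α k + 3 / 4 := by
      by_contra! hlt
      nlinarith
    refine ⟨hq, ?_, ?_, ?_⟩
    · have : 1 ≤ 1 / α (k + 1) := by linarith
      rwa [le_div_iff₀ hq, one_mul] at this
    · push_cast; linarith
    · push_cast; linarith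

lemma sub_min_le_of_lipschitz_gradient {E : Type*} [NormedAddCommGroup E]
    [InnerProductSpace ℝ E] [CompleteSpace E] {F : E → ℝ} {L : ℝ} (hL : 0 ≤ L)
    (hdiff : Differentiable ℝ F)
    (hsm : ∀ x y, ‖gradient F x - gradient F y‖ ≤ L * ‖x - y‖) {w : E} (hw : ∀ z, F w ≤ F z)
    (x : E) : F x - F w ≤ L * ‖x - w‖ ^ 2 := by
  have hgrad : gradient F w = 0 := by
    have : fderiv ℝ F w = 0 := IsLocalMin.fderiv_eq_zero (Filter.Eventually.of_forall hw)
    simp [gradient, this]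
  have hb : ∀ z ∈ Metric.closedBall w ‖x - w‖, ‖fderiv ℝ F z‖ ≤ L * ‖x - w‖ := by
    intro z hz
    have h := hsm z w
    rw [hgrad, sub_zero, gradient, LinearIsometryEquiv.norm_map] at h
    rw [Metric.mem_closedBall, dist_eq_norm] at hz
    exact h.trans (mul_le_mul_of_nonneg_left hz hL)
  have h := (convex_closedBall w ‖x - w‖).norm_image_sub_le_of_norm_fderiv_le
    (fun z _ => hdiff z) hb (Metric.mem_closedBall_self (norm_nonneg _))
    (y := x) (by rw [Metric.mem_closedBall, dist_eq_norm])
  rw [Real.norm_eq_abs] at h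
  calc F x - F w ≤ |F x - F w| := le_abs_self _
    _ ≤ L * ‖x - w‖ * ‖x - w‖ := h
    _ = L * ‖x - w‖ ^ 2 := by ring

theorem statement11 {N : ℕ} (L : ℝ)
    (F : EuclideanSpace ℝ (Fin N) → ℝ) (hdiff : Differentiable ℝ F)
    (hconv : ConvexOn ℝ Set.univ F)
    (hsm : ∀ x y, ‖gradient F x - gradient F y‖ ≤ L * ‖x - y‖)
    (xopt : EuclideanSpace ℝ (Fin N)) (hxopt : ∀ z, F xopt ≤ F z)
    (γ Δ : ℝ) (hγ : 0 < γ)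
    (S : ℕ)
    (x y : ℕ → EuclideanSpace ℝ (Fin N)) (α : ℕ → ℝ)
    (hΔ : Δ = F (x 0) - F xopt)
    (hα0 : α 0 = 1)
    (hy1 : y 1 = x 0)
    (hα : ∀ s, 1 ≤ s → s ≤ S →
      α s ∈ Set.Ioo (0 : ℝ) 1 ∧ (α s) ^ 2 = (1 - α s) * (α (s - 1)) ^ 2)
    (hx : ∀ s, 1 ≤ s → s ≤ S → ∀ z,
      F (x s) + L * ‖x s - y s‖ ^ 2 ≤
        F z + L * ‖z - y s‖ ^ 2 + 2 * Δ / (9 * ((s : ℝ) + 1) ^ ((4 : ℝ) + γ)))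
    (hy : ∀ s, 1 ≤ s → s ≤ S →
      y (s + 1) = x s +
        (α (s - 1) * (1 - α (s - 1)) / ((α (s - 1)) ^ 2 + α s)) • (x s - x (s - 1))) :
    F (x S) - F xopt ≤
      8 / ((S : ℝ) + 1) ^ 2 * (L * ‖x 0 - xopt‖ ^ 2 + 4 * Δ / γ ^ 2) := by
  have hΔ0 : 0 ≤ Δ := by rw [hΔ]; linarith [hxopt (x 0)]
  rcases lt_or_ge L 0 with hLneg | hL
  · have hsub : ∀ a b : EuclideanSpace ℝ (Fin N), a = b := by
      intro a b
      by_contra hab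
      have hpos : 0 < ‖a - b‖ := norm_pos_iff.2 (sub_ne_zero.2 hab)
      nlinarith [hsm a b, norm_nonneg (gradient F a - gradient F b)]
    have hz : Δ = 0 := by rw [hΔ, hsub (x 0) xopt, sub_self]
    rw [hsub (x S) xopt, hsub (x 0) xopt, hz]
    simp
  rcases S with _ | n
  · have h := sub_min_le_of_lipschitz_gradient hL hdiff hsm hxopt (x 0)
    have hnn : 0 ≤ L * ‖x 0 - xopt‖ ^ 2 := by positivity
    have hnn' : 0 ≤ 4 * Δ / γ ^ 2 := by positivity
    norm_num
    linarith
  obtain ⟨l, hl, rfl⟩ : ∃ l : ℝ, 0 ≤ l ∧ l ^ 2 = L :=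
    ⟨√L, Real.sqrt_nonneg L, Real.sq_sqrt hL⟩
  have hrec : ∀ k < n + 1, 0 < α (k + 1) ∧ α (k + 1) ^ 2 = (1 - α (k + 1)) * α k ^ 2 := by
    intro k hk
    have h := hα (k + 1) (by omega) (by omega)
    exact ⟨h.1.1, h.2⟩
  have hbd := accelerated_inv_bounds hα0 hrec
  set d : ℝ := √(2 * Δ) with hd
  have hd0 : 0 ≤ d := Real.sqrt_nonneg _
  have hd2 : d ^ 2 = 2 * Δ := Real.sq_sqrt (by linarith)
  set p : ℝ := γ / 2 with hp
  have hp0 : 0 < p := by positivity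
  set e : ℕ → ℝ := fun k => d / 3 * ((k : ℝ) + 2) ^ (-2 - p) with he
  have he0 : ∀ k, 0 ≤ e k := fun k => by positivity
  have heps : ∀ k : ℕ,
      2 * Δ / (9 * (((k + 1 : ℕ) : ℝ) + 1) ^ ((4 : ℝ) + γ)) = e k ^ 2 := by
    intro k
    have hk : (0 : ℝ) < (k : ℝ) + 2 := by positivity
    have hk1 : ((k + 1 : ℕ) : ℝ) + 1 = (k : ℝ) + 2 := by push_cast; ring
    have hpow : (((k : ℝ) + 2) ^ (-2 - p)) ^ 2 = (((k : ℝ) + 2) ^ ((4 : ℝ) + γ))⁻¹ := by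
      rw [← Real.rpow_natCast, ← Real.rpow_mul hk.le, ← Real.rpow_neg hk.le]
      congr 1
      rw [hp]; push_cast; ring
    rw [hk1, he]
    simp only
    rw [mul_pow, hpow, div_pow, hd2]
    have := Real.rpow_pos_of_pos hk (4 + γ)
    field_simp
    norm_num
  set v : ℕ → EuclideanSpace ℝ (Fin N) :=
    fun k => x k + (1 / α k) • (x (k + 1) - x k) with hv
  set K : ℝ := 5 / 8 * d * (1 / p) with hK
  have hK0 : 0 ≤ K := by positivity
  set D : ℝ := l * ‖x 0 - xopt‖ with hD
  have hD0 : 0 ≤ D := by positivity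
  set W : ℕ → ℝ := fun k =>
    (1 / α k) ^ 2 * (F (x (k + 1)) - F xopt) + (l * ‖v k - xopt‖) ^ 2 with hW
  have hgap : ∀ z, 0 ≤ F z - F xopt := fun z => sub_nonneg.2 (hxopt z)
  have hW0 : ∀ k, 0 ≤ W k := fun k =>
    add_nonneg (mul_nonneg (sq_nonneg _) (hgap _)) (sq_nonneg _)
  -- passing from a one-step inequality to the bound on the potential
  have advance : ∀ k ≤ n, ∀ C : ℝ, 0 ≤ C →
      W k ≤ C ^ 2 + (1 / α k * e k) ^ 2 + 2 * (1 / α k * e k) * (l * ‖v k - xopt‖) →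
      √(W k) ≤ C + K * (((k : ℝ) + 1) ^ (-p) - ((k : ℝ) + 2) ^ (-p)) := by
    intro k hk C hC h
    obtain ⟨ha0, -, -, hhi⟩ := hbd k (by omega)
    have hae : 0 ≤ 1 / α k * e k := mul_nonneg (by positivity) (he0 k)
    have hle : l * ‖v k - xopt‖ ≤ √(W k) := by
      refine Real.le_sqrt_of_sq_le ?_
      have := mul_nonneg (sq_nonneg (1 / α k)) (hgap (x (k + 1)))
      simp only [hW]
      linarith
    have h1 : √(W k) ^ 2 ≤ C ^ 2 + (1 / α k * e k) ^ 2 + 2 * (1 / α k * e k) * √(W k) := by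
      rw [Real.sq_sqrt (hW0 k)]
      nlinarith [mul_le_mul_of_nonneg_left hle hae]
    have h2 := le_add_of_sq_le_recursion hC hae h1
    have hk2 : (0 : ℝ) < (k : ℝ) + 2 := by positivity
    have htel := rpow_neg_one_sub_le_telescope (m := (k : ℝ) + 1) (by positivity) hp0
    rw [show (k : ℝ) + 1 + 1 = k + 2 by ring] at htel
    have h3 : 1 / α k * e k ≤ d / 4 * ((k : ℝ) + 2) ^ (-1 - p) := by
      calc 1 / α k * e k ≤ 3 / 4 * ((k : ℝ) + 2) * e k :=
            mul_le_mul_of_nonneg_right hhi (he0 k)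
        _ = d / 4 * (((k : ℝ) + 2) ^ (-2 - p) * ((k : ℝ) + 2)) := by rw [he]; ring
        _ = d / 4 * ((k : ℝ) + 2) ^ (-1 - p) := by
            rw [← Real.rpow_add_one hk2.ne']
            congr 2
            ring
    have h4 := mul_le_mul_of_nonneg_left htel (by positivity : 0 ≤ 5 / 8 * d)
    rw [hK]
    linarith
  have main : ∀ k ≤ n, √(W k) ≤ D + K * (1 - ((k : ℝ) + 2) ^ (-p)) := by
    intro k
    induction k with
    | zero =>
      intro hk
      have hstep := inexact_accelerated_prox_step hconv hl (he0 0) (a := α 0) (by simp [hα0])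
        hα0.le (x := x 1) (y := y 1) (p := x 0) (u := x 0) (w := xopt)
        (fun z => by have := hx 1 le_rfl (by omega) z; rwa [← heps 0]) (by simp [hy1])
      have h := advance 0 hk D hD0 (by
        simp only [hW, hv]
        rw [hα0] at hstep ⊢
        simpa [hD] using hstep)
      simpa using h
    | succ k ih =>
      intro hk
      have ihk := ih (by omega)
      obtain ⟨ha0, ha1, -, -⟩ := hbd k (by omega)
      obtain ⟨hb0, hb1, -, -⟩ := hbd (k + 1) (by omega)
      have hr := (hrec k (by omega)).2
      have hyk : y (k + 2) = x (k + 1) + α (k + 1) • (v k - x (k + 1)) := by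
        have h := hy (k + 1) (by omega) (by omega)
        have hβ : α k * (1 - α k) / (α k ^ 2 + α (k + 1)) = α (k + 1) * (1 / α k - 1) := by
          have hpos : 0 < α k ^ 2 + α (k + 1) := by positivity
          rw [div_eq_iff hpos.ne']
          field_simp
          linear_combination -(1 - α k) * hr
        simp only [Nat.add_sub_cancel] at h
        rw [h, hβ, hv]
        module
      have hstep := inexact_accelerated_prox_step hconv hl (he0 (k + 1)) hb0 hb1
        (x := x (k + 2)) (w := xopt)
        (fun z => by have := hx (k + 2) (by omega) (by omega) z; rwa [← heps (k + 1)]) hyk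
      have hcoef : (1 - α (k + 1)) * (1 / α (k + 1)) ^ 2 = (1 / α k) ^ 2 := by
        field_simp
        linarith
      rw [hcoef] at hstep
      have h := advance (k + 1) hk (√(W k)) (Real.sqrt_nonneg _) (by
        rw [Real.sq_sqrt (hW0 k)]
        exact hstep)
      push_cast at h ⊢
      rw [show (k : ℝ) + 1 + 1 = k + 2 by ring] at h
      linarith
  obtain ⟨-, -, hlo, -⟩ := hbd n (by omega)
  have hn0 : (0 : ℝ) < (n : ℝ) + 2 := by positivity
  have hDK : √(W n) ≤ D + K := by
    have h := main n le_rfl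
    have := mul_nonneg hK0 (Real.rpow_pos_of_pos hn0 (-p)).le
    linarith
  have hWn : W n ≤ 2 * D ^ 2 + 2 * K ^ 2 := by
    have h := pow_le_pow_left₀ (Real.sqrt_nonneg _) hDK 2
    rw [Real.sq_sqrt (hW0 n)] at h
    nlinarith [sq_nonneg (D - K)]
  have hK2 : 2 * K ^ 2 ≤ 8 * Δ / γ ^ 2 := by
    have : 2 * K ^ 2 = 25 / 4 * (Δ / γ ^ 2) := by
      rw [hK, hp, mul_pow, mul_pow, hd2]
      field_simp
      ring
    have h0 : 0 ≤ Δ / γ ^ 2 := by positivity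
    rw [this, mul_div_assoc]
    linarith
  have hsq : (((n : ℝ) + 2) / 2) ^ 2 * (F (x (n + 1)) - F xopt) ≤ W n := by
    have h1 := mul_le_mul_of_nonneg_right (pow_le_pow_left₀ (by positivity) hlo 2)
      (hgap (x (n + 1)))
    have h2 := sq_nonneg (l * ‖v n - xopt‖)
    simp only [hW]
    linarith
  have hD2 : D ^ 2 = l ^ 2 * ‖x 0 - xopt‖ ^ 2 := by rw [hD]; ring
  push_cast
  rw [show (n : ℝ) + 1 + 1 = n + 2 by ring, div_mul_eq_mul_div, le_div_iff₀ (by positivity),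
    ← hD2]
  have h8 : 8 * Δ / γ ^ 2 = 2 * (4 * Δ / γ ^ 2) := by ring
  linarith
end
end

section
/- Let F: ℝⁿ → ℝ be L-smooth and bounded below, let F* = inf F, and let Δ = F(x⁰) − F* for a given x⁰. Fix S ≥ 1, and for s = 1, 2, …, S let x^s satisfy F(x^s) + L‖x^s − x^{s−1}‖² ≤ min_x [ F(x) + L‖x − x^{s−1}‖² ] + Δ/S. Then (1/S) Σ_{s=1}^S ‖∇F(x^s)‖² ≤ 32 L Δ / S. -/
/-
STATEMENT 12: Nonconvex Catalyst guarantee: for L-smooth F bounded below with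
F* = inf F and Δ = F(x⁰) − F*, if for s = 1,…,S the iterate x^s satisfies
F(x^s) + L‖x^s − x^{s−1}‖² ≤ min_x [F(x) + L‖x − x^{s−1}‖²] + Δ/S, then
(1/S) Σ_{s=1}^S ‖∇F(x^s)‖² ≤ 32LΔ/S.
-/

noncomputable section

open scoped RealInnerProductSpace

section Helpers

variable {E : Type*} [NormedAddCommGroup E] [InnerProductSpace ℝ E] [CompleteSpace E]

/-- The descent lemma: a function with `L`-Lipschitz gradient lies below its quadratic model. -/
theorem le_quadratic_of_gradient_lipschitz {L : ℝ} {F : E → ℝ} (hdiff : Differentiable ℝ F)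
    (hsm : ∀ x y, ‖gradient F x - gradient F y‖ ≤ L * ‖x - y‖) (x d : E) :
    F (x + d) ≤ F x + ⟪gradient F x, d⟫ + L / 2 * ‖d‖ ^ 2 := by
  set h : ℝ → ℝ := fun t => F (x + t • d) - t * ⟪gradient F x, d⟫ - L / 2 * ‖d‖ ^ 2 * t ^ 2
  have hder : ∀ t, HasDerivAt h
      (⟪gradient F (x + t • d), d⟫ - ⟪gradient F x, d⟫ - L * ‖d‖ ^ 2 * t) t := by
    intro t
    have hline : HasDerivAt (fun t : ℝ => x + t • d) d t := by
      simpa using ((hasDerivAt_id t).smul_const d).const_add x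
    have hF : HasDerivAt (fun t : ℝ => F (x + t • d)) ⟪gradient F (x + t • d), d⟫ t := by
      exact (hdiff (x + t • d)).hasGradientAt.hasFDerivAt.comp_hasDerivAt t hline
    have hlin := (hasDerivAt_id t).mul_const ⟪gradient F x, d⟫
    have hquad := (hasDerivAt_pow 2 t).const_mul (L / 2 * ‖d‖ ^ 2)
    refine ((hF.sub hlin).sub hquad).congr_deriv ?_
    norm_num
    ring
  have hanti : AntitoneOn h (Set.Icc 0 1) := by
    refine antitoneOn_of_deriv_nonpos (convex_Icc 0 1)
      (fun t _ => (hder t).continuousAt.continuousWithinAt)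
      (fun t _ => (hder t).differentiableAt.differentiableWithinAt) fun t ht => ?_
    rw [interior_Icc] at ht
    rw [(hder t).deriv, ← inner_sub_left]
    have hcs := real_inner_le_norm (gradient F (x + t • d) - gradient F x) d
    have hlip := hsm (x + t • d) x
    rw [add_sub_cancel_left, norm_smul, Real.norm_of_nonneg ht.1.le] at hlip
    nlinarith [mul_le_mul_of_nonneg_right hlip (norm_nonneg d)]
  have := hanti (Set.left_mem_Icc.2 zero_le_one) (Set.right_mem_Icc.2 zero_le_one) zero_le_one
  simp only [h, one_smul, zero_smul, add_zero] at this
  linarith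

/-- An `ε`-minimizer of `F + L ‖· - c‖²` has a small gradient of that (`3L`-smooth) function. -/
theorem norm_sq_gradient_prox_le {L ε : ℝ} (hL : 0 ≤ L) {F : E → ℝ} (hdiff : Differentiable ℝ F)
    (hsm : ∀ x y, ‖gradient F x - gradient F y‖ ≤ L * ‖x - y‖) {x c : E}
    (hx : ∀ z, F x + L * ‖x - c‖ ^ 2 ≤ F z + L * ‖z - c‖ ^ 2 + ε) :
    ‖gradient F x + (2 * L) • (x - c)‖ ^ 2 ≤ 6 * L * ε := by
  set v := gradient F x + (2 * L) • (x - c) with hv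
  have key : ∀ t : ℝ, t * ‖v‖ ^ 2 - 3 * L / 2 * t ^ 2 * ‖v‖ ^ 2 ≤ ε := by
    intro t
    have hdesc := le_quadratic_of_gradient_lipschitz hdiff hsm x (-(t • v))
    have hmin := hx (x + -(t • v))
    have hsq : ‖x + -(t • v) - c‖ ^ 2 = ‖x - c‖ ^ 2 - 2 * t * ⟪x - c, v⟫ + t ^ 2 * ‖v‖ ^ 2 := by
      rw [show x + -(t • v) - c = (x - c) - t • v by abel, norm_sub_sq_real, inner_smul_right,
        norm_smul, mul_pow, Real.norm_eq_abs, sq_abs]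
      ring
    have hvv : ⟪gradient F x, v⟫ = ‖v‖ ^ 2 - 2 * L * ⟪x - c, v⟫ := by
      rw [← real_inner_self_eq_norm_sq, ← real_inner_smul_left, ← inner_sub_left]
      congr 1
      rw [hv]
      abel
    rw [hsq] at hmin
    rw [norm_neg, norm_smul, mul_pow, Real.norm_eq_abs, sq_abs, inner_neg_right, inner_smul_right,
      hvv] at hdesc
    linarith
  rcases hL.eq_or_lt with rfl | hL
  · by_contra! hpos
    have h := key ((ε + 1) / ‖v‖ ^ 2)
    have hne : ‖v‖ ^ 2 ≠ 0 := by intro h0; simp [h0] at hpos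
    rw [div_mul_cancel₀ _ hne] at h
    simp at h
    linarith
  · have h := key (1 / (3 * L))
    have heq : 1 / (3 * L) * ‖v‖ ^ 2 - 3 * L / 2 * (1 / (3 * L)) ^ 2 * ‖v‖ ^ 2
        = ‖v‖ ^ 2 / (6 * L) := by
      field_simp
      ring
    rw [heq, div_le_iff₀ (by positivity)] at h
    linarith

/-- One inexact proximal step: the gradient at the new point is controlled by the decrease. -/
theorem norm_sq_gradient_le_of_prox_step {L ε : ℝ} (hL : 0 ≤ L) {F : E → ℝ}
    (hdiff : Differentiable ℝ F)
    (hsm : ∀ x y, ‖gradient F x - gradient F y‖ ≤ L * ‖x - y‖) {x c : E}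
    (hx : ∀ z, F x + L * ‖x - c‖ ^ 2 ≤ F z + L * ‖z - c‖ ^ 2 + ε) :
    ‖gradient F x‖ ^ 2 ≤ 12 * L * ε + 8 * L * (F c - F x + ε) := by
  have hv := norm_sq_gradient_prox_le hL hdiff hsm hx
  have hc := hx c
  rw [sub_self, norm_zero] at hc
  have hpar := parallelogram_law_with_norm ℝ (gradient F x + (2 * L) • (x - c))
    ((2 * L) • (x - c))
  rw [add_sub_cancel_right, norm_smul, Real.norm_of_nonneg (by positivity : 0 ≤ 2 * L)] at hpar
  nlinarith [mul_le_mul_of_nonneg_left hc hL,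
    mul_self_nonneg ‖gradient F x + (2 * L) • (x - c) + (2 * L) • (x - c)‖]

end Helpers

theorem statement12 {N : ℕ} (L : ℝ)
    (F : EuclideanSpace ℝ (Fin N) → ℝ) (hdiff : Differentiable ℝ F)
    (hsm : ∀ x y, ‖gradient F x - gradient F y‖ ≤ L * ‖x - y‖)
    (hbdd : BddBelow (Set.range F))
    (Fstar : ℝ) (hFstar : Fstar = sInf (Set.range F))
    (x : ℕ → EuclideanSpace ℝ (Fin N))
    (Δ : ℝ) (hΔ : Δ = F (x 0) - Fstar)
    (S : ℕ) (hS : 1 ≤ S)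
    (hx : ∀ s, 1 ≤ s → s ≤ S → ∀ z,
      F (x s) + L * ‖x s - x (s - 1)‖ ^ 2 ≤
        F z + L * ‖z - x (s - 1)‖ ^ 2 + Δ / (S : ℝ)) :
    (1 / (S : ℝ)) * ∑ s ∈ Finset.Icc 1 S, ‖gradient F (x s)‖ ^ 2 ≤
      32 * L * Δ / (S : ℝ) := by
  have hSpos : (0 : ℝ) < S := by exact_mod_cast hS
  have hlow : ∀ z, Fstar ≤ F z := fun z => hFstar ▸ csInf_le hbdd ⟨z, rfl⟩
  have hΔ0 : 0 ≤ Δ := hΔ ▸ sub_nonneg.2 (hlow _)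
  rw [one_div, inv_mul_eq_div]
  refine div_le_div_of_nonneg_right ?_ hSpos.le
  rcases le_or_gt 0 L with hL | hL
  · have hsum : ∀ k ≤ S, ∑ s ∈ Finset.Icc 1 k, ‖gradient F (x s)‖ ^ 2 ≤
        12 * L * (k * (Δ / S)) + 8 * L * (F (x 0) - F (x k) + k * (Δ / S)) := by
      intro k
      induction k with
      | zero => simp
      | succ k ih =>
        intro hk
        have hstep := norm_sq_gradient_le_of_prox_step hL hdiff hsm (hx (k + 1) (by omega) hk)
        rw [Nat.add_sub_cancel] at hstep
        rw [Finset.sum_Icc_succ_top (by omega)]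
        push_cast
        linarith [ih (by omega)]
    have h := hsum S le_rfl
    rw [mul_div_cancel₀ _ hSpos.ne'] at h
    nlinarith [mul_nonneg hL (sub_nonneg.2 (hlow (x S))), mul_nonneg hL hΔ0]
  · -- a negative Lipschitz constant forces the space to be trivial
    have hsub : ∀ a b : EuclideanSpace ℝ (Fin N), a = b := by
      intro a b
      have h := (norm_nonneg _).trans (hsm a b)
      exact sub_eq_zero.1 (norm_le_zero_iff.1 (nonpos_of_mul_nonneg_right h hL))
    have hF : Fstar = F (x 0) := by
      have hr : Set.range F = {F (x 0)} := by
        ext r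
        simp only [Set.mem_range, Set.mem_singleton_iff]
        exact ⟨fun ⟨y, hy⟩ => by rw [← hy, hsub y (x 0)], fun h => ⟨x 0, h.symm⟩⟩
      rw [hFstar, hr, csInf_singleton]
    have hg : ∀ z, gradient F z = 0 := fun z => hsub _ _
    simp [hg, hΔ, hF]
end
end

section
/- Let μ ≤ ℓ, let 𝒳 ⊆ ℝᵈ be nonempty, closed and convex, let f: ℝᵈ → ℝ be μ-strongly convex and ℓ-smooth with x* the unique minimizer of f over 𝒳, and set κ = ℓ/μ. Let g: ℝᵈ → ℝᵈ be an inexact gradient oracle with ‖g(x) − ∇f(x)‖ ≤ δ for all x. Starting from y₀ = x₀ ∈ 𝒳, define for t ≥ 0: x_{t+1} = Π_𝒳( y_t − (1/(2ℓ)) g(y_t) ) and y_{t+1} = x_{t+1} + β (x_{t+1} − x_t) with β = (2 − √(μ/ℓ))/(2 + √(μ/ℓ)), where Π_𝒳 is the Euclidean projection onto 𝒳. Then for every T ≥ 0, f(x_T) − f(x*) ≤ exp(−T/(2√κ)) ( f(x₀) − f(x*) + (μ/4)‖x₀ − x*‖² ) + √κ ( 1/ℓ + 2/μ ) δ². -/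
/-
STATEMENT 13: Inexact accelerated projected gradient descent. For f μ-strongly convex
and ℓ-smooth (0 < μ ≤ ℓ), 𝒳 nonempty closed convex with x* the minimizer of f over 𝒳,
an inexact gradient oracle g with ‖g(x) − ∇f(x)‖ ≤ δ, and iterates
x_{t+1} = Π_𝒳(y_t − (1/(2ℓ)) g(y_t)), y_{t+1} = x_{t+1} + β(x_{t+1} − x_t),
β = (2 − √(μ/ℓ))/(2 + √(μ/ℓ)), y₀ = x₀ ∈ 𝒳, one has for every T (κ = ℓ/μ):
f(x_T) − f(x*) ≤ exp(−T/(2√κ))(f(x₀) − f(x*) + (μ/4)‖x₀ − x*‖²) + √κ(1/ℓ + 2/μ)δ².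
-/

noncomputable section

open scoped RealInnerProductSpace

section AcceleratedDescent

variable {E : Type*} [NormedAddCommGroup E] [InnerProductSpace ℝ E]

/-- The descent lemma for a function with Lipschitz gradient. -/
theorem le_add_inner_gradient_add_sq [CompleteSpace E] {f : E → ℝ} {ℓ : ℝ}
    (hdiff : Differentiable ℝ f)
    (hsm : ∀ x y, ‖gradient f x - gradient f y‖ ≤ ℓ * ‖x - y‖) (y z : E) :
    f z ≤ f y + ⟪gradient f y, z - y⟫ + ℓ / 2 * ‖z - y‖ ^ 2 := by
  set h := z - y with hh
  let φ : ℝ → ℝ := fun t => f (y + t • h) - t * ⟪gradient f y, h⟫ - ℓ / 2 * t ^ 2 * ‖h‖ ^ 2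
  have hφ : ∀ t, HasDerivAt φ
      (⟪gradient f (y + t • h) - gradient f y, h⟫ - ℓ * t * ‖h‖ ^ 2) t := by
    intro t
    have hline : HasDerivAt (fun t : ℝ => y + t • h) h t := by
      simpa using ((hasDerivAt_id t).smul_const h).const_add y
    have hf : HasDerivAt (fun t : ℝ => f (y + t • h)) ⟪gradient f (y + t • h), h⟫ t := by
      exact (hdiff (y + t • h)).hasGradientAt.hasFDerivAt.comp_hasDerivAt t hline
    have hlin := (hasDerivAt_id t).mul_const ⟪gradient f y, h⟫
    have hsq := (((hasDerivAt_id t).pow 2).const_mul (ℓ / 2)).mul_const (‖h‖ ^ 2)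
    refine ((hf.sub hlin).sub hsq).congr_deriv ?_
    simp only [inner_sub_left, id]
    push_cast
    ring
  have hanti : AntitoneOn φ (Set.Icc 0 1) := by
    refine antitoneOn_of_deriv_nonpos (convex_Icc 0 1)
      (fun t _ => (hφ t).continuousAt.continuousWithinAt)
      (fun t _ => (hφ t).differentiableAt.differentiableWithinAt) fun t ht => ?_
    rw [interior_Icc] at ht
    rw [(hφ t).deriv]
    have hlip := hsm (y + t • h) y
    rw [add_sub_cancel_left, norm_smul, Real.norm_of_nonneg ht.1.le] at hlip
    have hcs := real_inner_le_norm (gradient f (y + t • h) - gradient f y) h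
    nlinarith [mul_le_mul_of_nonneg_right hlip (norm_nonneg h)]
  have h01 := hanti (Set.left_mem_Icc.2 zero_le_one) (Set.right_mem_Icc.2 zero_le_one) zero_le_one
  simp only [φ, one_smul, zero_smul, add_zero, hh, add_sub_cancel] at h01
  linarith

/-- The variational inequality for a nearest point of a convex set. -/
theorem inner_sub_nearest_nonpos {K : Set E} (hK : Convex ℝ K) {u p : E} (hp : p ∈ K)
    (hmin : ∀ w ∈ K, ‖u - p‖ ≤ ‖u - w‖) {w : E} (hw : w ∈ K) : ⟪u - p, w - p⟫ ≤ 0 := by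
  refine (norm_eq_iInf_iff_real_inner_le_zero hK hp).1 ?_ w hw
  have : Nonempty K := ⟨⟨p, hp⟩⟩
  refine le_antisymm (le_ciInf fun w => hmin w w.2) ?_
  exact ciInf_le (f := fun w : K => ‖u - w‖)
    ⟨0, by rintro _ ⟨w, rfl⟩; exact norm_nonneg _⟩ ⟨p, hp⟩

/-- Young's inequality for inner products. -/
theorem inner_le_sq_div_add {c δ : ℝ} (hc : 0 < c) {e h : E} (he : ‖e‖ ≤ δ) :
    ⟪e, h⟫ ≤ δ ^ 2 / (2 * c) + c / 2 * ‖h‖ ^ 2 := by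
  have hcs : ⟪e, h⟫ ≤ δ * ‖h‖ :=
    (real_inner_le_norm e h).trans (mul_le_mul_of_nonneg_right he (norm_nonneg h))
  have hsq : δ ^ 2 / (2 * c) + c / 2 * ‖h‖ ^ 2 - δ * ‖h‖ = (δ - c * ‖h‖) ^ 2 / (2 * c) := by
    field_simp
    ring
  have : 0 ≤ (δ - c * ‖h‖) ^ 2 / (2 * c) := by positivity
  linarith

/-- One inexact projected gradient step of length `1 / (2 * ℓ)`, compared with a feasible point. -/
theorem inexact_projected_gradient_step [CompleteSpace E] {μ ℓ δ : ℝ} (hμ : 0 < μ) (hℓ : 0 < ℓ)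
    {K : Set E} (hK : Convex ℝ K) {f : E → ℝ} (hdiff : Differentiable ℝ f)
    (hsc : ∀ x y, f x + ⟪gradient f x, y - x⟫ + μ / 2 * ‖y - x‖ ^ 2 ≤ f y)
    (hsm : ∀ x y, ‖gradient f x - gradient f y‖ ≤ ℓ * ‖x - y‖)
    {y p G : E} (hG : ‖G - gradient f y‖ ≤ δ) (hp : p ∈ K)
    (hmin : ∀ w ∈ K, ‖y - (1 / (2 * ℓ)) • G - p‖ ≤ ‖y - (1 / (2 * ℓ)) • G - w‖)
    {z : E} (hz : z ∈ K) :
    f p - f z ≤ -(2 * ℓ) * ⟪p - y, y - z⟫ - ℓ * ‖p - y‖ ^ 2 - μ / 4 * ‖y - z‖ ^ 2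
      + (1 / ℓ + 2 / μ) / 2 * δ ^ 2 := by
  have hdesc := le_add_inner_gradient_add_sq hdiff hsm y p
  have hconv := hsc y z
  have hvar := inner_sub_nearest_nonpos hK hp hmin hz
  have he : ‖gradient f y - G‖ ≤ δ := by rwa [norm_sub_rev]
  have hyoung₁ := inner_le_sq_div_add hℓ (h := p - y) he
  have hyoung₂ := inner_le_sq_div_add (half_pos hμ) (h := y - z) he
  have hexp : ⟪y - (1 / (2 * ℓ)) • G - p, z - p⟫ =
      ⟪p - y, p - y⟫ + ⟪p - y, y - z⟫ + 1 / (2 * ℓ) * (⟪G, p - y⟫ + ⟪G, y - z⟫) := by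
    rw [show y - (1 / (2 * ℓ)) • G - p = -(p - y) - (1 / (2 * ℓ)) • G by abel,
      show z - p = -(p - y) - (y - z) by abel]
    simp only [inner_sub_left _ ((1 / (2 * ℓ)) • G), inner_sub_right _ (-(p - y)) (y - z),
      inner_neg_left, inner_neg_right, real_inner_smul_left]
    ring
  rw [hexp, real_inner_self_eq_norm_sq] at hvar
  have hvar' : 2 * ℓ * (‖p - y‖ ^ 2 + ⟪p - y, y - z⟫) + (⟪G, p - y⟫ + ⟪G, y - z⟫) ≤ 0 := by
    have := mul_le_mul_of_nonneg_left hvar (by positivity : 0 ≤ 2 * ℓ)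
    field_simp at this
    linarith
  rw [inner_sub_left] at hyoung₁ hyoung₂
  rw [show z - y = -(y - z) by abel, inner_neg_right, norm_neg] at hconv
  have hδ : (1 / ℓ + 2 / μ) / 2 * δ ^ 2 = δ ^ 2 / (2 * ℓ) + δ ^ 2 / (2 * (μ / 2)) := by
    field_simp
  rw [hδ]
  linarith

/-- The decrease of the Lyapunov function of accelerated gradient descent, in terms of
`c = y - x⋆`, `u = v - x⋆` and `p = (z - y) / s`, where `z` is the next iterate and `v` the
auxiliary sequence. -/
theorem accelerated_lyapunov_decrease {M m s ε G F F' : ℝ} (hm : 0 ≤ m) (hs : 0 ≤ s) (hs1 : s ≤ 1)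
    (hMm : M * s ^ 2 = m) {u c p : E}
    (hx : G - F ≤ -M * ⟪s • p, s • (u - c)⟫ - M / 2 * ‖s • p‖ ^ 2
      - m / 2 * ‖s • (u - c)‖ ^ 2 + ε)
    (hstar : G - F' ≤ -M * ⟪s • p, c⟫ - M / 2 * ‖s • p‖ ^ 2 - m / 2 * ‖c‖ ^ 2 + ε) :
    G - F' + m / 2 * ‖(1 - s) • u + s • c + p‖ ^ 2 ≤
      (1 - s) * (F - F' + m / 2 * ‖u‖ ^ 2) + ε := by
  have h1 := mul_le_mul_of_nonneg_left hx (sub_nonneg.2 hs1)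
  have h2 := mul_le_mul_of_nonneg_left hstar hs
  have hnn : 0 ≤ m / 2 * ((1 - s) * (s + s ^ 2) * ‖u - c‖ ^ 2) := by
    have := sub_nonneg.2 hs1
    positivity
  subst hMm
  simp only [← real_inner_self_eq_norm_sq, inner_add_left, inner_add_right, inner_sub_left,
    inner_sub_right, real_inner_smul_left, real_inner_smul_right] at *
  rw [real_inner_comm u c, real_inner_comm p c, real_inner_comm p u] at *
  linarith

end AcceleratedDescent

/-- Unrolling a contraction with additive error. -/
theorem le_exp_mul_add_div_of_contraction {V : ℕ → ℝ} {s ε : ℝ} (hs : 0 < s) (hs1 : s ≤ 1)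
    (hε : 0 ≤ ε) (hV0 : 0 ≤ V 0) (hV : ∀ t, V (t + 1) ≤ (1 - s) * V t + ε) (T : ℕ) :
    V T ≤ Real.exp (-(s * T)) * V 0 + ε / s := by
  induction T with
  | zero => simpa using div_nonneg hε hs.le
  | succ t ih =>
    have hexp : Real.exp (-(s * (t + 1 : ℕ))) = Real.exp (-s) * Real.exp (-(s * t)) := by
      rw [← Real.exp_add]
      push_cast
      ring_nf
    have h1 : 1 - s ≤ Real.exp (-s) := by linarith [Real.add_one_le_exp (-s)]
    have h2 := mul_le_mul_of_nonneg_left ih (sub_nonneg.2 hs1)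
    have h3 := mul_le_mul_of_nonneg_right h1 (mul_nonneg (Real.exp_pos (-(s * t))).le hV0)
    have h4 : (1 - s) * (ε / s) + ε = ε / s := by
      field_simp
      ring
    rw [hexp]
    linarith [hV t]

theorem statement13 {d : ℕ} (μ ℓ : ℝ) (hμ : 0 < μ) (hμℓ : μ ≤ ℓ)
    (𝒳 : Set (EuclideanSpace ℝ (Fin d))) (hne : 𝒳.Nonempty)
    (hclosed : IsClosed 𝒳) (hconv : Convex ℝ 𝒳)
    (f : EuclideanSpace ℝ (Fin d) → ℝ) (hdiff : Differentiable ℝ f)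
    (hsc : ∀ x y, f x + ⟪gradient f x, y - x⟫ + μ / 2 * ‖y - x‖ ^ 2 ≤ f y)
    (hsm : ∀ x y, ‖gradient f x - gradient f y‖ ≤ ℓ * ‖x - y‖)
    (xstar : EuclideanSpace ℝ (Fin d)) (hxstarmem : xstar ∈ 𝒳)
    (hxstarmin : ∀ z ∈ 𝒳, f xstar ≤ f z)
    (g : EuclideanSpace ℝ (Fin d) → EuclideanSpace ℝ (Fin d))
    (δ : ℝ) (hg : ∀ z, ‖g z - gradient f z‖ ≤ δ)
    (proj : EuclideanSpace ℝ (Fin d) → EuclideanSpace ℝ (Fin d))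
    (hproj : ∀ z, proj z ∈ 𝒳 ∧ ∀ w ∈ 𝒳, ‖z - proj z‖ ≤ ‖z - w‖)
    (β : ℝ) (hβ : β = (2 - Real.sqrt (μ / ℓ)) / (2 + Real.sqrt (μ / ℓ)))
    (x y : ℕ → EuclideanSpace ℝ (Fin d))
    (hx0 : x 0 ∈ 𝒳) (hy0 : y 0 = x 0)
    (hx : ∀ t, x (t + 1) = proj (y t - (1 / (2 * ℓ)) • g (y t)))
    (hy : ∀ t, y (t + 1) = x (t + 1) + β • (x (t + 1) - x t)) :
    ∀ T : ℕ, f (x T) - f xstar ≤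
      Real.exp (-(T : ℝ) / (2 * Real.sqrt (ℓ / μ))) *
        (f (x 0) - f xstar + μ / 4 * ‖x 0 - xstar‖ ^ 2)
      + Real.sqrt (ℓ / μ) * (1 / ℓ + 2 / μ) * δ ^ 2 := by
  have hℓ : 0 < ℓ := hμ.trans_le hμℓ
  set r := Real.sqrt (μ / ℓ) with hr
  have hr0 : 0 < r := Real.sqrt_pos.2 (div_pos hμ hℓ)
  have hr1 : r ≤ 1 := Real.sqrt_le_one.2 ((div_le_one hℓ).2 hμℓ)
  have hrsq : ℓ * r ^ 2 = μ := by
    rw [hr, Real.sq_sqrt (div_pos hμ hℓ).le]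
    field_simp
  have hκ : Real.sqrt (ℓ / μ) = r⁻¹ := by rw [hr, ← Real.sqrt_inv, inv_div]
  set s := r / 2 with hs
  have hs0 : 0 < s := half_pos hr0
  have hs1 : s ≤ 1 := by linarith
  have hxmem : ∀ t, x t ∈ 𝒳
    | 0 => hx0
    | t + 1 => hx t ▸ (hproj _).1
  let u : ℕ → EuclideanSpace ℝ (Fin d) := fun t => y t - xstar + s⁻¹ • (y t - x t)
  have hu0 : u 0 = x 0 - xstar := by simp [u, hy0]
  have hβs : s⁻¹ * β + β = s⁻¹ - 1 := by
    rw [hβ, hs]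
    field_simp
  have husucc : ∀ t, u (t + 1) =
      (1 - s) • u t + s • (y t - xstar) + s⁻¹ • (x (t + 1) - y t) := by
    intro t
    have hβs' : β = s⁻¹ - 1 - s⁻¹ * β := by linarith
    simp only [u, hy t, add_sub_cancel_left]
    rw [show x (t + 1) + β • (x (t + 1) - x t) - xstar + s⁻¹ • β • (x (t + 1) - x t) =
      x (t + 1) - xstar + (s⁻¹ * β + β) • (x (t + 1) - x t) by module, hβs]
    match_scalars <;> field_simp <;> ring
  let V : ℕ → ℝ := fun t => f (x t) - f xstar + μ / 2 / 2 * ‖u t‖ ^ 2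
  have hV : ∀ t, V (t + 1) ≤ (1 - s) * V t + (1 / ℓ + 2 / μ) / 2 * δ ^ 2 := by
    intro t
    have hstep := fun {z} (hz : z ∈ 𝒳) => inexact_projected_gradient_step hμ hℓ hconv hdiff hsc hsm
      (hg (y t)) (hxmem (t + 1)) (by rw [hx t]; exact (hproj _).2) hz
    have hp : s • s⁻¹ • (x (t + 1) - y t) = x (t + 1) - y t := smul_inv_smul₀ hs0.ne' _
    have huc : s • (u t - (y t - xstar)) = y t - x t := by
      simp only [u, add_sub_cancel_left]
      exact smul_inv_smul₀ hs0.ne' _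
    simp only [V]
    rw [husucc t]
    refine accelerated_lyapunov_decrease (M := 2 * ℓ) (half_pos hμ).le hs0.le hs1
      (by rw [hs, ← hrsq]; ring) ?_ ?_
    · rw [hp, huc]
      linarith [hstep (hxmem t)]
    · rw [hp]
      linarith [hstep hxstarmem]
  intro T
  have hV0 : 0 ≤ V 0 :=
    add_nonneg (sub_nonneg.2 (hxstarmin _ hx0)) (by positivity)
  have hVT := le_exp_mul_add_div_of_contraction hs0 hs1 (by positivity) hV0 hV T
  have hfV : f (x T) - f xstar ≤ V T := le_add_of_nonneg_right (by positivity)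
  have hexp : -(T : ℝ) / (2 * r⁻¹) = -(s * T) := by
    rw [hs]
    field_simp
  have herr : (1 / ℓ + 2 / μ) / 2 * δ ^ 2 / s = r⁻¹ * (1 / ℓ + 2 / μ) * δ ^ 2 := by
    rw [hs]
    field_simp
  have hV0eq : V 0 = f (x 0) - f xstar + μ / 4 * ‖x 0 - xstar‖ ^ 2 := by
    simp only [V, hu0]
    ring
  rw [hκ, hexp, ← herr, ← hV0eq]
  exact hfV.trans hVT
end
end
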